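/- arXiv:1610.09774 — 2 statements merged into one kernel-verified Lean document; each statement's English description precedes it below -/
import Mathlib

section
/- There exists a constant C > 0 such that for all integers n and s with n sufficiently large and C · log₂ log₂ n ≤ s ≤ n, λ(s,n) ≥ n · (s / (2·log₂(log n / log s) + 1))^(log₂(log n / log s) + 1), where log denotes the natural logarithm (so log n / log s = log_s n). -/
/-- The alternating sequence `a, b, a, b, ...` of length `k`. -/
def altSeq {α : Type*} (a b : α) : ℕ → List α
  | 0 => []
  | k + 1 => a :: altSeq b a k

/-- `l` avoids alternations of length `k`: it has no (not necessarily contiguous)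
subsequence `a, b, a, b, ...` of length `k` with `a ≠ b`. -/
def AvoidsAlt {α : Type*} (l : List α) (k : ℕ) : Prop :=
  ∀ a b : α, a ≠ b → ¬ (altSeq a b k).Sublist l

/-- `l` is an order-`s` Davenport–Schinzel sequence over an alphabet of `n` symbols:
no two consecutive entries are equal and it avoids alternations of length `s + 2`. -/
def IsDS (s n : ℕ) (l : List (Fin n)) : Prop :=
  l.Chain' (· ≠ ·) ∧ AvoidsAlt l (s + 2)

/-- `lambdaDS s n` is the maximum length of an order-`s` Davenport–Schinzel
sequence over an alphabet of `n` symbols. -/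
noncomputable def lambdaDS (s n : ℕ) : ℕ :=
  sSup { L | ∃ l : List (Fin n), IsDS s n l ∧ l.length = L }

lemma length_altSeq {α : Type*} (a b : α) (k : ℕ) : (altSeq a b k).length = k := by
  induction k generalizing a b with
  | zero => rfl
  | succ k ih => simp [altSeq, ih]

lemma map_altSeq {α β : Type*} (g : α → β) (a b : α) (k : ℕ) :
    (altSeq a b k).map g = altSeq (g a) (g b) k := by
  induction k generalizing a b with
  | zero => rfl
  | succ k ih => simp [altSeq, ih]

lemma altSeq_even_append {α : Type*} (a b : α) (t m : ℕ) :
    altSeq a b (2 * t) ++ altSeq a b m = altSeq a b (2 * t + m) := by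
  induction t with
  | zero => simp [altSeq]
  | succ t ih =>
    rw [show 2 * (t + 1) = 2 * t + 1 + 1 by ring,
      show 2 * t + 1 + 1 + m = 2 * t + m + 1 + 1 by ring]
    simp only [altSeq, List.cons_append, ih]

lemma flatten_replicate_altSeq {α : Type*} (a b : α) (t N : ℕ) :
    (List.replicate N (altSeq a b (2 * t))).flatten = altSeq a b (2 * (t * N)) := by
  induction N with
  | zero => simp [altSeq]
  | succ N ih =>
    rw [List.replicate_succ, List.flatten_cons, ih, altSeq_even_append]
    congr 1
    ring

lemma isChain_altSeq {α : Type*} {a b : α} (h : a ≠ b) (k : ℕ) :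
    (altSeq a b k).IsChain (· ≠ ·) := by
  induction k generalizing a b with
  | zero => simp [altSeq]
  | succ k ih =>
    cases k with
    | zero => simp [altSeq]
    | succ k =>
      have := ih h.symm
      simp only [altSeq] at this ⊢
      exact List.IsChain.cons_cons h this

lemma altSeq_prefix {α : Type*} (a b : α) {j k : ℕ} (h : j ≤ k) :
    (altSeq a b j).Sublist (altSeq a b k) := by
  induction j generalizing a b k with
  | zero => simp [altSeq]
  | succ j ih =>
    obtain ⟨k, rfl⟩ : ∃ k', k = k' + 1 := ⟨k - 1, by omega⟩
    exact (ih b a (by omega)).cons_cons a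

lemma altSeq_eq_append {α : Type*} {a b : α} {k : ℕ} {x y : List α}
    (h : altSeq a b k = x ++ y) :
    x = altSeq a b x.length ∧ (y = altSeq a b y.length ∨ y = altSeq b a y.length) := by
  induction x generalizing a b k with
  | nil =>
    simp only [List.nil_append] at h
    subst h
    simp [altSeq, length_altSeq]
  | cons c x ih =>
    cases k with
    | zero => simp [altSeq] at h
    | succ k =>
      simp only [altSeq, List.cons_append, List.cons.injEq] at h
      obtain ⟨rfl, h⟩ := h
      obtain ⟨h1, h2⟩ := ih h
      refine ⟨?_, h2.symm⟩
      rw [List.length_cons, altSeq, ← h1]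

lemma mem_altSeq {α : Type*} (a b : α) {k : ℕ} (h : 2 ≤ k) :
    a ∈ altSeq a b k ∧ b ∈ altSeq a b k := by
  obtain ⟨k, rfl⟩ : ∃ k', k = k' + 1 + 1 := ⟨k - 2, by omega⟩
  simp [altSeq]

/-- Alternations of `a` and `b` inside `l` have length at most `c`. -/
def AltBound {α : Type*} (l : List α) (a b : α) (c : ℕ) : Prop :=
  ∀ k, (altSeq a b k).Sublist l ∨ (altSeq b a k).Sublist l → k ≤ c

lemma AltBound.symm {α : Type*} {l : List α} {a b : α} {c : ℕ} (h : AltBound l a b c) :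
    AltBound l b a c :=
  fun k hk => h k hk.symm

lemma AltBound.mono {α : Type*} {l : List α} {a b : α} {c d : ℕ} (h : AltBound l a b c)
    (hcd : c ≤ d) : AltBound l a b d :=
  fun k hk => (h k hk).trans hcd

lemma AltBound.append {α : Type*} {l₁ l₂ : List α} {a b : α} {c₁ c₂ : ℕ}
    (h₁ : AltBound l₁ a b c₁) (h₂ : AltBound l₂ a b c₂) :
    AltBound (l₁ ++ l₂) a b (c₁ + c₂) := by
  have key : ∀ {a b : α} (k : ℕ), AltBound l₁ a b c₁ → AltBound l₂ a b c₂ →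
      (altSeq a b k).Sublist (l₁ ++ l₂) → k ≤ c₁ + c₂ := by
    intro a b k h₁ h₂ hk
    obtain ⟨x, y, hxy, hx, hy⟩ := List.sublist_append_iff.1 hk
    obtain ⟨ex, ey⟩ := altSeq_eq_append hxy
    have hlen : k = x.length + y.length := by
      rw [← length_altSeq a b k, hxy, List.length_append]
    have b1 : x.length ≤ c₁ := h₁ _ (Or.inl (ex ▸ hx))
    have b2 : y.length ≤ c₂ := by
      rcases ey with ey | ey
      · exact h₂ _ (Or.inl (ey ▸ hy))
      · exact h₂ _ (Or.inr (ey ▸ hy))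
    omega
  rintro k (hk | hk)
  · exact key k h₁ h₂ hk
  · exact key k h₁.symm h₂.symm hk

lemma AltBound.flatMap {ι α : Type*} {a b : α} {g : ι → List α} {c : ι → ℕ}
    (h : ∀ i, AltBound (g i) a b (c i)) (I : List ι) :
    AltBound (I.flatMap g) a b (I.map c).sum := by
  induction I with
  | nil =>
    rintro k (hk | hk) <;> simpa [length_altSeq] using hk.length_le
  | cons i I ih => simpa using (h i).append ih

lemma altBound_of_notMem {α : Type*} {l : List α} {a b : α} (hb : b ∉ l) :
    AltBound l a b 1 := by
  intro k hk
  by_contra hlt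
  push Not at hlt
  rcases hk with hk | hk
  · exact hb (hk.subset (mem_altSeq a b hlt).2)
  · exact hb (hk.subset (mem_altSeq b a hlt).1)

lemma altBound_of_notMem_notMem {α : Type*} {l : List α} {a b : α} (ha : a ∉ l) (hb : b ∉ l) :
    AltBound l a b 0 := by
  intro k hk
  by_contra hlt
  obtain ⟨k, rfl⟩ : ∃ k', k = k' + 1 := ⟨k - 1, by omega⟩
  rcases hk with hk | hk
  · exact ha (hk.subset (by simp [altSeq]))
  · exact hb (hk.subset (by simp [altSeq]))

lemma AvoidsAlt.altBound {α : Type*} {l : List α} {k : ℕ} (h : AvoidsAlt l (k + 1)) {a b : α}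
    (hab : a ≠ b) : AltBound l a b k := by
  intro j hj
  by_contra hlt
  push Not at hlt
  rcases hj with hj | hj
  · exact h a b hab ((altSeq_prefix a b hlt).trans hj)
  · exact h b a hab.symm ((altSeq_prefix b a hlt).trans hj)

lemma AvoidsAlt.of_altBound {α : Type*} {l : List α} {k : ℕ}
    (h : ∀ a b : α, a ≠ b → AltBound l a b k) : AvoidsAlt l (k + 1) :=
  fun a b hab hk => absurd (h a b hab _ (Or.inl hk)) (by omega)

lemma AvoidsAlt.mono {α : Type*} {l : List α} {j k : ℕ} (h : AvoidsAlt l j) (hjk : j ≤ k) :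
    AvoidsAlt l k :=
  fun a b hab hk => h a b hab ((altSeq_prefix a b hjk).trans hk)

lemma AltBound.map {α β : Type*} {g : α → β} (hg : Function.Injective g) {l : List α} {a b : α}
    {c : ℕ} (h : AltBound l a b c) : AltBound (l.map g) (g a) (g b) c := by
  have key : ∀ a b k, (altSeq (g a) (g b) k).Sublist (l.map g) → (altSeq a b k).Sublist l := by
    intro a b k hk
    obtain ⟨l', hl', e⟩ := List.sublist_map_iff.1 hk
    rw [← map_altSeq] at e
    rwa [List.map_injective_iff.2 hg e]
  rintro k (hk | hk)
  · exact h k (Or.inl (key _ _ _ hk))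
  · exact h k (Or.inr (key _ _ _ hk))

open Classical in
lemma AvoidsAlt.altBound_map {α β : Type*} {g : α → β} (hg : Function.Injective g) {l : List α}
    {k : ℕ} (h : AvoidsAlt l (k + 1)) {v w : β} (hvw : v ≠ w) :
    AltBound (l.map g) v w (if v ∈ Set.range g ∧ w ∈ Set.range g then k else
      (if v ∈ Set.range g then 1 else 0) + (if w ∈ Set.range g then 1 else 0)) := by
  have hmem : ∀ u, u ∉ Set.range g → u ∉ l.map g := by
    intro u hu hu'
    obtain ⟨x, -, rfl⟩ := List.mem_map.1 hu'
    exact hu ⟨x, rfl⟩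
  by_cases hv : v ∈ Set.range g <;> by_cases hw : w ∈ Set.range g <;> simp only [hv, hw, and_self,
    and_true, and_false, if_true, if_false, zero_add, add_zero]
  · obtain ⟨x, rfl⟩ := hv
    obtain ⟨y, rfl⟩ := hw
    exact (h.altBound (fun e => hvw (congrArg g e))).map hg
  · exact altBound_of_notMem (hmem _ hw)
  · exact (altBound_of_notMem (hmem _ hv)).symm
  · exact altBound_of_notMem_notMem (hmem _ hv) (hmem _ hw)

/-- An order-`s` Davenport–Schinzel sequence all of whose periodic repetitions avoid
immediate repetitions. -/
def IsCyclicDS {α : Type*} (s : ℕ) (l : List α) : Prop :=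
  (∀ N, ((List.replicate N l).flatten).IsChain (· ≠ ·)) ∧ AvoidsAlt l (s + 2)

lemma IsCyclicDS.map {α β : Type*} {s : ℕ} {l : List α} (h : IsCyclicDS s l) {g : α → β}
    (hg : Function.Injective g) : IsCyclicDS s (l.map g) := by
  classical
  refine ⟨fun N => ?_, ?_⟩
  · rw [← List.map_replicate, ← List.map_flatten, List.isChain_map]
    exact (h.1 N).imp fun a b hab => hg.ne hab
  · refine AvoidsAlt.of_altBound (k := s + 1) fun a b hab => ?_
    refine (AvoidsAlt.altBound_map (k := s + 1) hg h.2 hab).mono ?_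
    split_ifs <;> first | omega | tauto

lemma isCyclicDS_altSeq {α : Type*} {a b : α} (hab : a ≠ b) {t : ℕ} (ht : 1 ≤ t) :
    IsCyclicDS (2 * t - 1) (altSeq a b (2 * t)) := by
  refine ⟨fun N => ?_, fun c d _ h => ?_⟩
  · rw [flatten_replicate_altSeq]
    exact isChain_altSeq hab _
  · have := h.length_le
    simp only [length_altSeq] at this
    omega

/-- The lines with slopes indexed by `Fin r` in `A × B`, each carrying a copy of `l`. -/
noncomputable def lineSeq {A B : Type*} [AddCommGroup B] [Fintype B] {r : ℕ}
    (f : Fin r → A → B) (l : List A) : List (A × B) :=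
  (Finset.univ : Finset (Fin r × B)).toList.flatMap fun i => l.map fun x => (x, i.2 + f i.1 x)

lemma length_lineSeq {A B : Type*} [AddCommGroup B] [Fintype B] {r : ℕ}
    (f : Fin r → A → B) (l : List A) :
    (lineSeq f l).length = r * Fintype.card B * l.length := by
  simp [lineSeq, List.length_flatMap, List.map_const', Fintype.card_prod]

lemma flatMap_const {ι α : Type*} (I : List ι) (l : List α) :
    (I.flatMap fun _ => l) = (List.replicate I.length l).flatten := by
  rw [List.flatMap, List.map_const']

open Classical in
lemma sum_line_cost {A B : Type*} [AddCommGroup B] [Fintype B] {r : ℕ}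
    (f : Fin r → A → B) (hf : ∀ i j, i ≠ j → ∀ x y, f i x - f i y = f j x - f j y → x = y)
    (hr : 1 ≤ r) {k : ℕ} (hk : 2 ≤ k) {v w : A × B} (hvw : v ≠ w) :
    ∑ i : Fin r × B, (if v.2 = i.2 + f i.1 v.1 ∧ w.2 = i.2 + f i.1 w.1 then k else
      (if v.2 = i.2 + f i.1 v.1 then 1 else 0) + (if w.2 = i.2 + f i.1 w.1 then 1 else 0)) ≤
      k + 2 * (r - 1) := by
  have inner : ∀ m : Fin r, ∑ c : B, (if v.2 = c + f m v.1 ∧ w.2 = c + f m w.1 then k else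
      (if v.2 = c + f m v.1 then 1 else 0) + (if w.2 = c + f m w.1 then 1 else 0)) ≤
      2 + (if v.2 - f m v.1 = w.2 - f m w.1 then k - 2 else 0) := by
    intro m
    have e1 : ∀ (u : A × B) (c : B), u.2 = c + f m u.1 ↔ u.2 - f m u.1 = c := by
      intro u c
      rw [sub_eq_iff_eq_add]
    simp only [e1]
    by_cases h : v.2 - f m v.1 = w.2 - f m w.1
    · simp only [h, and_self, if_true]
      have : ∀ c : B, (if w.2 - f m w.1 = c then k else
          (if w.2 - f m w.1 = c then 1 else 0) + (if w.2 - f m w.1 = c then 1 else 0)) =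
          if w.2 - f m w.1 = c then k else 0 := by
        intro c; split_ifs <;> rfl
      simp only [this, Finset.sum_ite_eq, Finset.mem_univ, if_true]
      omega
    · have : ∀ c : B, (if v.2 - f m v.1 = c ∧ w.2 - f m w.1 = c then k else
          (if v.2 - f m v.1 = c then 1 else 0) + (if w.2 - f m w.1 = c then 1 else 0)) =
          (if v.2 - f m v.1 = c then 1 else 0) + (if w.2 - f m w.1 = c then 1 else 0) := by
        intro c
        rw [if_neg]
        rintro ⟨h1, h2⟩
        exact h (h1.trans h2.symm)
      simp only [this, Finset.sum_add_distrib, Finset.sum_ite_eq, Finset.mem_univ, if_true]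
      omega
  rw [Fintype.sum_prod_type]
  refine (Finset.sum_le_sum fun m _ => inner m).trans ?_
  rw [Finset.sum_add_distrib]
  have hone : ∑ m : Fin r, (if v.2 - f m v.1 = w.2 - f m w.1 then k - 2 else 0) ≤ k - 2 := by
    by_cases hex : ∃ m, v.2 - f m v.1 = w.2 - f m w.1
    · obtain ⟨m, hm⟩ := hex
      rw [Finset.sum_eq_single m]
      · simp [hm]
      · intro j _ hj
        rw [if_neg]
        intro hj'
        have hx : v.1 = w.1 := by
          refine hf j m hj _ _ ?_
          have key : ∀ k, v.2 - f k v.1 = w.2 - f k w.1 → f k v.1 - f k w.1 = v.2 - w.2 := by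
            intro k hk
            calc f k v.1 - f k w.1 = v.2 - w.2 - ((v.2 - f k v.1) - (w.2 - f k w.1)) := by abel
              _ = v.2 - w.2 := by rw [hk, sub_self, sub_zero]
          rw [key j hj', key m hm]
        rw [hx] at hm
        exact hvw (Prod.ext hx (sub_left_injective hm))
      · simp
    · push Not at hex
      simp [hex]
  simp only [Finset.sum_const, Finset.card_univ, Fintype.card_fin, smul_eq_mul]
  omega

lemma IsCyclicDS.lineSeq {A B : Type*} [AddCommGroup B] [Fintype B] {r s : ℕ}
    (f : Fin r → A → B) (hf : ∀ i j, i ≠ j → ∀ x y, f i x - f i y = f j x - f j y → x = y)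
    (hr : 1 ≤ r) (hs : 1 ≤ s) {l : List A} (h : IsCyclicDS s l) :
    IsCyclicDS (s + 2 * (r - 1)) (lineSeq f l) := by
  classical
  refine ⟨fun N => ?_, ?_⟩
  · have hmap : (((List.replicate N (_root_.lineSeq f l)).flatten).map Prod.fst) =
        (List.replicate (N * (Finset.univ : Finset (Fin r × B)).toList.length) l).flatten := by
      rw [List.map_flatten, List.map_replicate, _root_.lineSeq, List.map_flatMap]
      simp only [List.map_map, Function.comp_def, List.map_id']
      rw [flatMap_const, ← List.flatten_replicate_replicate, List.flatten_flatten,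
        List.map_replicate]
    have := h.1 (N * (Finset.univ : Finset (Fin r × B)).toList.length)
    rw [← hmap, List.isChain_map] at this
    exact this.imp fun a b hab e => hab (e ▸ rfl)
  · rw [show s + 2 * (r - 1) + 2 = (s + 1 + 2 * (r - 1)) + 1 by ring]
    refine AvoidsAlt.of_altBound fun v w hvw => ?_
    have hg : ∀ i : Fin r × B, Function.Injective fun x => (x, i.2 + f i.1 x) :=
      fun i x y e => congrArg Prod.fst e
    have := AltBound.flatMap (fun i => h.2.altBound_map (hg i) hvw)
      (Finset.univ : Finset (Fin r × B)).toList
    refine this.mono ?_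
    have hmem : ∀ (u : A × B) (i : Fin r × B),
        (u ∈ Set.range fun x => (x, i.2 + f i.1 x)) ↔ u.2 = i.2 + f i.1 u.1 := by
      intro u i
      constructor
      · rintro ⟨x, rfl⟩; rfl
      · intro e; exact ⟨u.1, Prod.ext rfl e.symm⟩
    rw [Finset.sum_map_toList]
    simp only [hmem]
    exact sum_line_cost f hf hr (by omega) hvw


/-- Over `n` symbols there is a cyclic order-`s` sequence in which the symbols occur `d` times
on average. -/
def HasDensity (s n d : ℕ) : Prop :=
  ∃ l : List (Fin n), IsCyclicDS s l ∧ l.length = n * d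

lemma hasDensity_two {t : ℕ} (ht : 1 ≤ t) : HasDensity (2 * t - 1) 2 t :=
  ⟨altSeq 0 1 (2 * t), isCyclicDS_altSeq (by decide) ht, length_altSeq _ _ _⟩

lemma HasDensity.of_lines {s a b d r : ℕ} [NeZero b] (h : HasDensity s a d)
    (f : Fin r → Fin a → ZMod b)
    (hf : ∀ i j, i ≠ j → ∀ x y, f i x - f i y = f j x - f j y → x = y)
    (hr : 1 ≤ r) (hs : 1 ≤ s) : HasDensity (s + 2 * (r - 1)) (a * b) (r * d) := by
  obtain ⟨l, hl, hlen⟩ := h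
  have e : Fin a × ZMod b ≃ Fin (a * b) := Fintype.equivFinOfCardEq (by simp [ZMod.card])
  refine ⟨(lineSeq f l).map e, (hl.lineSeq f hf hr hs).map e.injective, ?_⟩
  rw [List.length_map, length_lineSeq, hlen, ZMod.card]
  ring

lemma HasDensity.mul_prime {s a p d r : ℕ} (h : HasDensity s a d) (hp : p.Prime) (hap : a ≤ p)
    (hrp : r ≤ p) (hr : 1 ≤ r) (hs : 1 ≤ s) :
    HasDensity (s + 2 * (r - 1)) (a * p) (r * d) := by
  have : Fact p.Prime := ⟨hp⟩
  have cast_inj : ∀ {i j : ℕ}, i < p → j < p → (i : ZMod p) = j → i = j := by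
    intro i j hi hj hij
    rw [ZMod.natCast_eq_natCast_iff'] at hij
    rwa [Nat.mod_eq_of_lt hi, Nat.mod_eq_of_lt hj] at hij
  refine h.of_lines (fun i x => ((i : ℕ) : ZMod p) * ((x : ℕ) : ZMod p)) ?_ hr hs
  intro i j hij x y hxy
  have hprod : (((i : ℕ) : ZMod p) - ((j : ℕ) : ZMod p)) *
      (((x : ℕ) : ZMod p) - ((y : ℕ) : ZMod p)) = 0 := by
    linear_combination hxy
  rcases mul_eq_zero.1 hprod with h0 | h0
  · exact absurd (Fin.ext (cast_inj (by omega) (by omega) (sub_eq_zero.1 h0))) hij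
  · exact Fin.ext (cast_inj (by omega) (by omega) (sub_eq_zero.1 h0))

lemma HasDensity.mul {s a d : ℕ} (h : HasDensity s a d) (hs : 1 ≤ s) {b : ℕ} (hb : b ≠ 0) :
    HasDensity s (a * b) d := by
  have : NeZero b := ⟨hb⟩
  have := h.of_lines (r := 1) (b := b) (fun _ _ => 0)
    (fun i j hij => absurd (Subsingleton.elim i j) hij) le_rfl hs
  simpa using this

lemma HasDensity.iterate {s n d r : ℕ} (h : HasDensity s n d) (hs : 1 ≤ s) (hr : 1 ≤ r)
    (hrn : r ≤ n) (k : ℕ) : ∃ m, r ≤ m ∧ 2 * m ≤ (2 * n) ^ 2 ^ k ∧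
      HasDensity (s + 2 * k * (r - 1)) m (r ^ k * d) := by
  induction k with
  | zero => exact ⟨n, hrn, by simp, by simpa using h⟩
  | succ k ih =>
    obtain ⟨m, hrm, hmn, hm⟩ := ih
    obtain ⟨p, hp, hmp, hpm⟩ := Nat.exists_prime_lt_and_le_two_mul m (by omega)
    refine ⟨m * p, hrm.trans (Nat.le_mul_of_pos_right m hp.pos), ?_, ?_⟩
    · calc 2 * (m * p) ≤ 2 * (m * (2 * m)) := by gcongr
        _ = (2 * m) ^ 2 := by ring
        _ ≤ ((2 * n) ^ 2 ^ k) ^ 2 := by gcongr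
        _ = (2 * n) ^ 2 ^ (k + 1) := by rw [← pow_mul, pow_succ]
    · have := hm.mul_prime hp hmp.le (hrm.trans hmp.le) hr (by omega)
      convert this using 1 <;> ring

/-- The entries of a list, grouped into consecutive disjoint pairs. -/
def listPairs {α : Type*} : List α → List (α × α)
  | a :: b :: l => (a, b) :: listPairs l
  | _ => []

lemma length_le_listPairs {α : Type*} : ∀ l : List α, l.length ≤ 2 * (listPairs l).length + 1
  | [] => by simp
  | [_] => by simp
  | a :: b :: l => by
    have := length_le_listPairs l
    simp only [listPairs, List.length_cons]
    omega

lemma flatMap_listPairs_sublist {α : Type*} :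
    ∀ l : List α, ((listPairs l).flatMap fun p => [p.1, p.2]).Sublist l
  | [] => by simp [listPairs]
  | [_] => by simp [listPairs]
  | a :: b :: l => by
    simpa [listPairs] using flatMap_listPairs_sublist l

lemma ne_of_mem_listPairs {α : Type*} :
    ∀ l : List α, l.IsChain (· ≠ ·) → ∀ p ∈ listPairs l, p.1 ≠ p.2
  | [], _, p, hp => by simp [listPairs] at hp
  | [_], _, p, hp => by simp [listPairs] at hp
  | a :: b :: l, h, p, hp => by
    simp only [listPairs, List.mem_cons] at hp
    rw [List.isChain_cons_cons] at h
    rcases hp with rfl | hp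
    · exact h.1
    · exact ne_of_mem_listPairs l h.2.tail p hp

lemma flatMap_replicate_pair {α : Type*} (a b : α) (k : ℕ) :
    ((List.replicate k (a, b)).flatMap fun p => [p.1, p.2]) = altSeq a b (2 * k) := by
  induction k with
  | zero => simp [altSeq]
  | succ k ih =>
    rw [List.replicate_succ, List.flatMap_cons, ih, show 2 * (k + 1) = 2 * k + 1 + 1 by ring]
    simp [altSeq]

lemma length_le_card_mul {α : Type*} [Fintype α] {l : List α} {c : ℕ}
    (h : ∀ a, ¬ (List.replicate (c + 1) a).Sublist l) : l.length ≤ Fintype.card α * c := by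
  classical
  have hsum := Multiset.sum_count_eq_card (s := (Finset.univ : Finset α))
    (m := (l : Multiset α)) (by simp)
  rw [Multiset.coe_card] at hsum
  rw [← hsum]
  refine (Finset.sum_le_sum fun a _ => ?_).trans_eq (b := ∑ _a : α, c) (by simp)
  rw [Multiset.coe_count]
  by_contra hlt
  exact h a (List.replicate_sublist_iff.2 (by omega))

lemma IsDS.length_le {s n : ℕ} {l : List (Fin n)} (h : IsDS s n l) :
    l.length ≤ 2 * (n * n * (s + 1)) + 1 := by
  have hpairs : (listPairs l).length ≤ n * n * (s + 1) := by
    refine (length_le_card_mul (c := s + 1) fun p hp => ?_).trans_eq (by simp)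
    refine h.2 p.1 p.2 (ne_of_mem_listPairs l h.1 p (hp.subset (by simp))) ?_
    have h1 := hp.flatMap (fun p => [p.1, p.2])
    rw [flatMap_replicate_pair] at h1
    exact (altSeq_prefix p.1 p.2 (by omega)).trans (h1.trans (flatMap_listPairs_sublist l))
  have := length_le_listPairs l
  omega

lemma IsDS.length_le_lambdaDS {s n : ℕ} {l : List (Fin n)} (h : IsDS s n l) :
    l.length ≤ lambdaDS s n :=
  le_csSup ⟨2 * (n * n * (s + 1)) + 1, by rintro _ ⟨l', hl', rfl⟩; exact hl'.length_le⟩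
    ⟨l, h, rfl⟩

lemma HasDensity.mul_le_lambdaDS {s s' m n d : ℕ} (h : HasDensity s m d) (hs : 1 ≤ s)
    (hss : s ≤ s') (hm : 1 ≤ m) (hmn : m ≤ n) : n * d ≤ 2 * lambdaDS s' n := by
  have hb : 1 ≤ n / m := (Nat.one_le_div_iff (by omega)).2 hmn
  obtain ⟨l, hl, hlen⟩ := h.mul hs (b := n / m) (by omega)
  have hle : m * (n / m) ≤ n := Nat.mul_div_le n m
  have hmap := hl.map (Fin.castLE_injective hle)
  have hDS : IsDS s' n (l.map (Fin.castLE hle)) :=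
    ⟨show List.IsChain _ _ by simpa using hmap.1 1, hmap.2.mono (by omega)⟩
  have := hDS.length_le_lambdaDS
  rw [List.length_map, hlen] at this
  have hn : n ≤ 2 * (m * (n / m)) := by
    have h1 := Nat.div_add_mod n m
    have h2 := Nat.mod_lt n (show 0 < m by omega)
    have h3 : m * 1 ≤ m * (n / m) := by gcongr
    omega
  calc n * d ≤ 2 * (m * (n / m)) * d := by gcongr
    _ = 2 * (m * (n / m) * d) := by ring
    _ ≤ _ := by gcongr

lemma le_lambdaDS_of_prime {n s r p k : ℕ} (hp : p.Prime) (hpr : 2 * p ≤ r)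
    (hn : (8 * p * r) ^ 2 ^ k ≤ n) (hs : (2 * k + 5) * (r - 1) ≤ s) :
    n * (r ^ (k + 1) * p * (r - 1)) ≤ 2 * lambdaDS s n := by
  have hp2 := hp.two_le
  obtain ⟨q, hq, hrq, hqr⟩ := Nat.exists_prime_lt_and_le_two_mul r (by omega)
  have h1 := (hasDensity_two (t := r - 1) (by omega)).mul_prime hp hp2 le_rfl (by omega)
    (by omega)
  have h2 := h1.mul_prime hq (by omega) hrq.le (by omega) (by omega)
  obtain ⟨m, hrm, hm, h3⟩ := h2.iterate (r := r) (by omega) (by omega)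
    (hrq.le.trans (Nat.le_mul_of_pos_left q (by omega))) k
  have hmn : m ≤ n := by
    have : (2 * (2 * p * q)) ^ 2 ^ k ≤ (8 * p * r) ^ 2 ^ k := by
      gcongr ?_ ^ _
      calc 2 * (2 * p * q) ≤ 2 * (2 * p * (2 * r)) := by gcongr
        _ = 8 * p * r := by ring
    omega
  refine le_trans (le_of_eq ?_) (h3.mul_le_lambdaDS (s' := s) (by omega) ?_ (by omega) hmn)
  · ring
  · refine le_trans ?_ hs
    have : (2 * k + 5) * (r - 1) = 2 * k * (r - 1) + 5 * (r - 1) := by ring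
    omega
lemma log_le_two_thirds_mul_sub_half {x : ℝ} (hx : 0 < x) :
    Real.log x ≤ 2 / 3 * x - 1 / 2 := by
  have h1 := Real.log_le_sub_one_of_pos (show 0 < 2 / 3 * x by positivity)
  have h2 := Real.log_le_sub_one_of_pos (show (0 : ℝ) < 3 / 2 by norm_num)
  have h3 : Real.log x = Real.log (2 / 3 * x) + Real.log (3 / 2) := by
    rw [← Real.log_mul (by positivity) (by norm_num)]
    congr 1
    ring
  linarith

lemma logb_two_le_sub_half {x : ℝ} (hx : 0 < x) (hx1 : 1 ≤ x) : Real.logb 2 x ≤ x - 1 / 2 := by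
  rw [← Real.log_div_log, div_le_iff₀ (Real.log_pos (by norm_num))]
  nlinarith [log_le_two_thirds_mul_sub_half hx, Real.log_two_gt_d9]

lemma mul_log_div_le {r s L K : ℝ} (hr : 0 < r) (hs : 0 < s) (hL : 0 ≤ L)
    (hLK : 2 * L ≤ 2 * K + 19) (hsr : s ≤ (2 * K + 20) * r) :
    (L + 1) * Real.log (s / (2 * L + 1)) ≤ (L + 1) * Real.log r + (2 * K + 19 - 2 * L) := by
  have hK : 0 < 2 * K + 20 := by linarith
  have h1 : Real.log (s / (2 * L + 1)) ≤ Real.log r + (2 * K + 19 - 2 * L) / (2 * L + 1) := by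
    calc Real.log (s / (2 * L + 1)) ≤ Real.log (r * ((2 * K + 20) / (2 * L + 1))) := by
          apply Real.log_le_log (by positivity)
          rw [← mul_div_assoc, mul_comm r]
          gcongr
      _ = Real.log r + Real.log ((2 * K + 20) / (2 * L + 1)) :=
          Real.log_mul (by positivity) (by positivity)
      _ ≤ Real.log r + ((2 * K + 20) / (2 * L + 1) - 1) := by
          gcongr
          exact Real.log_le_sub_one_of_pos (by positivity)
      _ = _ := by
          congr 1
          field_simp
          ring
  have h2 : (L + 1) * ((2 * K + 19 - 2 * L) / (2 * L + 1)) ≤ 2 * K + 19 - 2 * L := by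
    rw [← mul_div_assoc, div_le_iff₀ (by positivity)]
    nlinarith
  calc (L + 1) * Real.log (s / (2 * L + 1))
      ≤ (L + 1) * (Real.log r + (2 * K + 19 - 2 * L) / (2 * L + 1)) := by gcongr
    _ ≤ _ := by linarith

lemma rpow_div_le {r s z L : ℝ} {k : ℕ} (hr : Real.exp 64 ≤ r) (hrz : 16 * r ≤ z)
    (hzr : z ≤ (16 * r) ^ 2) (hs : 0 < s) (hsr : s ≤ (2 * k + 20) * r) (hL : 0 ≤ L)
    (hLk : L ≤ k + Real.logb 2 (Real.log z / Real.log (16 * r))) :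
    (s / (2 * L + 1)) ^ (L + 1) ≤ z * r ^ (k + 1) / 4096 := by
  have hr0 : 0 < r := (Real.exp_pos _).trans_le hr
  have hz0 : 0 < z := by linarith
  have hlr : 64 ≤ Real.log r := (Real.le_log_iff_exp_le hr0).2 hr
  have hlr16 : Real.log r ≤ Real.log (16 * r) := Real.log_le_log hr0 (by linarith)
  have hl16 : 0 < Real.log (16 * r) := by linarith
  set ρ := Real.log z / Real.log (16 * r) with hρ
  have hρ1 : 1 ≤ ρ := by
    rw [hρ, one_le_div hl16]
    exact Real.log_le_log (by positivity) hrz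
  have hρ2 : ρ ≤ 2 := by
    rw [hρ, div_le_iff₀ hl16]
    have := Real.log_le_log hz0 hzr
    rw [Real.log_pow] at this
    exact_mod_cast this
  have hδ := logb_two_le_sub_half (by linarith) hρ1
  have hlz : ρ * Real.log r ≤ Real.log z := by
    calc ρ * Real.log r ≤ ρ * Real.log (16 * r) := by gcongr
      _ = Real.log z := div_mul_cancel₀ _ hl16.ne'
  have hmain := mul_log_div_le hr0 hs hL (K := k) (by linarith) hsr
  have h4096 : Real.log 4096 ≤ 12 := by
    rw [show (4096 : ℝ) = 2 ^ 12 by norm_num, Real.log_pow]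
    have := Real.log_two_lt_d9
    norm_num
    linarith
  have hlog : (L + 1) * Real.log (s / (2 * L + 1)) ≤
      Real.log z + (k + 1) * Real.log r - Real.log 4096 := by
    nlinarith [mul_nonneg (sub_nonneg.2 hLk) (show 0 ≤ Real.log r - 2 by linarith),
      mul_nonneg (sub_nonneg.2 hδ) (show 0 ≤ Real.log r by linarith)]
  rw [← Real.log_le_log_iff (by positivity) (by positivity), Real.log_rpow (by positivity),
    Real.log_div (x := z * r ^ (k + 1)) (by positivity) (by norm_num),
    Real.log_mul (by positivity) (by positivity), Real.log_pow]
  exact_mod_cast hlog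

lemma exists_prime_mul_approx {r : ℕ} {z : ℝ} (hr : 4 ≤ r) (hrz : 16 * r ≤ z)
    (hzr : z ≤ (16 * r) ^ 2) :
    ∃ p : ℕ, p.Prime ∧ 2 * p ≤ r ∧ (8 * p * r : ℝ) ≤ z ∧ z ≤ 1024 * p * r := by
  have hr0 : (0 : ℝ) < r := by positivity
  have hz0 : 0 < z := by linarith
  set F := ⌊z / (8 * r)⌋₊ with hF
  have hF2 : 2 ≤ F := by
    rw [hF]
    apply Nat.le_floor
    rw [le_div_iff₀ (by positivity)]
    push_cast
    linarith
  have hFle : (F : ℝ) * (8 * r) ≤ z := by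
    rw [← le_div_iff₀ (by positivity)]
    exact Nat.floor_le (by positivity)
  have hFlt : z < (F + 1) * (8 * r) := by
    rw [← div_lt_iff₀ (by positivity)]
    exact Nat.lt_floor_add_one _
  obtain ⟨p, hp, hmp, hpm⟩ := Nat.exists_prime_lt_and_le_two_mul (min F (r / 2) / 2) (by omega)
  refine ⟨p, hp, by omega, ?_, ?_⟩
  · have hpF : (p : ℝ) ≤ F := by exact_mod_cast (by omega : p ≤ F)
    nlinarith
  · rcases le_total F (r / 2) with h | h
    · have hpF : (F + 1 : ℝ) ≤ 2 * p := by exact_mod_cast (by omega : F + 1 ≤ 2 * p)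
      nlinarith
    · have hpr : (r : ℝ) ≤ 4 * p := by exact_mod_cast (by omega : r ≤ 4 * p)
      nlinarith

lemma exists_last_scale {n s : ℕ} (hn : 80 ≤ n) (hsn : s ≤ n) :
    ∃ k, (16 * (s / (2 * k + 20) + 1)) ^ 2 ^ k ≤ n ∧
      n < ((16 * (s / (2 * k + 20) + 1)) ^ 2) ^ 2 ^ k := by
  classical
  have hex : ∃ k, n < (16 * (s / (2 * k + 20) + 1)) ^ 2 ^ k := by
    refine ⟨n, ?_⟩
    calc n < 2 ^ n := Nat.lt_two_pow_self
      _ < 2 ^ 2 ^ n := Nat.pow_lt_pow_right (by norm_num) Nat.lt_two_pow_self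
      _ ≤ _ := by
        gcongr
        generalize s / (2 * n + 20) = q
        omega
  have h0 : Nat.find hex ≠ 0 := by
    intro h
    have := Nat.find_spec hex
    rw [h] at this
    simp only [mul_zero, zero_add, pow_zero, pow_one] at this
    omega
  obtain ⟨k, hk⟩ := Nat.exists_eq_succ_of_ne_zero h0
  refine ⟨k, not_lt.1 (Nat.find_min hex (by omega)), ?_⟩
  have := Nat.find_spec hex
  rw [hk] at this
  refine this.trans_le ?_
  rw [← pow_mul, ← pow_succ', Nat.succ_eq_add_one]
  gcongr
  omega

lemma add_two_le_logb_logb {n : ℝ} {x k : ℕ} (hx : 1 ≤ x) (h : ((16 * x : ℕ) : ℝ) ^ 2 ^ k ≤ n) :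
    (k : ℝ) + 2 ≤ Real.logb 2 (Real.logb 2 n) := by
  have h16 : (2 : ℝ) ^ (2 ^ (k + 2)) ≤ n := by
    calc (2 : ℝ) ^ (2 ^ (k + 2)) = 16 ^ 2 ^ k := by
          rw [pow_add, mul_comm, pow_mul]
          norm_num
      _ ≤ ((16 * x : ℕ) : ℝ) ^ 2 ^ k := by
          gcongr
          exact_mod_cast (by omega : 16 ≤ 16 * x)
      _ ≤ n := h
  have hn : 0 < n := lt_of_lt_of_le (by positivity) h16
  have h1 : (2 : ℝ) ^ (k + 2) ≤ Real.logb 2 n := by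
    rw [Real.le_logb_iff_rpow_le (by norm_num) hn]
    exact_mod_cast h16
  rw [Real.le_logb_iff_rpow_le (by norm_num) (lt_of_lt_of_le (by positivity) h1)]
  exact_mod_cast h1

theorem stmt12 :
    ∃ C : ℝ, 0 < C ∧ ∃ N : ℕ, ∀ n s : ℕ, N ≤ n →
      C * Real.logb 2 (Real.logb 2 n) ≤ (s : ℝ) → s ≤ n →
      (n : ℝ) * ((s : ℝ) / (2 * Real.logb 2 (Real.log n / Real.log s) + 1)) ^
          (Real.logb 2 (Real.log n / Real.log s) + 1) ≤ (lambdaDS s n : ℝ) := by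
  refine ⟨10 * Real.exp 64, by positivity, 80, fun n s hn hs hsn => ?_⟩
  obtain ⟨k, hk, hk'⟩ := exists_last_scale hn hsn
  set u := s / (2 * k + 20) with hu
  have hΛ := add_two_le_logb_logb (n := n) (x := u + 1) (k := k) (Nat.le_add_left 1 u) (by exact_mod_cast hk)
  have hus : (2 * k + 20) * u ≤ s := Nat.mul_div_le s _
  have hsu : s < (2 * k + 20) * (u + 1) := Nat.lt_mul_div_succ s (by omega)
  have hsu' : (s : ℝ) ≤ (2 * k + 20) * ((u + 1 : ℕ) : ℝ) := by exact_mod_cast hsu.le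
  have hr : Real.exp 64 ≤ ((u + 1 : ℕ) : ℝ) := by
    have hE := Real.exp_pos 64
    have : (2 * k + 20) * Real.exp 64 ≤ (2 * k + 20) * ((u + 1 : ℕ) : ℝ) := by
      refine le_trans ?_ hsu'
      refine le_trans ?_ hs
      nlinarith
    exact le_of_mul_le_mul_left this (by positivity)
  have hr64 : 64 ≤ u := by
    have h1 := Real.add_one_le_exp (64 : ℝ)
    have h2 : (65 : ℝ) ≤ ((u + 1 : ℕ) : ℝ) := by linarith
    have h3 : 65 ≤ u + 1 := by exact_mod_cast h2
    omega
  have hrs : 16 * (u + 1) ≤ s := by nlinarith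
  set r := u + 1 with hrdef
  have hr0 : (0 : ℝ) < r := by positivity
  have hn0 : (0 : ℝ) < n := by positivity
  have hpow : (2 ^ k : ℕ) ≠ 0 := by positivity
  set z : ℝ := (n : ℝ) ^ (((2 ^ k : ℕ) : ℝ)⁻¹) with hz
  have hzn : z ^ 2 ^ k = n := Real.rpow_inv_natCast_pow hn0.le hpow
  have hz0 : 0 ≤ z := by positivity
  have hrz : 16 * (r : ℝ) ≤ z := by
    rw [← pow_le_pow_iff_left₀ (by positivity) hz0 hpow, hzn]
    exact_mod_cast hk
  have hzr : z ≤ (16 * (r : ℝ)) ^ 2 := by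
    rw [← pow_le_pow_iff_left₀ hz0 (by positivity) hpow, hzn]
    exact_mod_cast hk'.le
  obtain ⟨p, hp, hpr, hpz, hzp⟩ := exists_prime_mul_approx (by omega) hrz hzr
  have hcomb := le_lambdaDS_of_prime (n := n) (s := s) (k := k) hp hpr
    (by
      have : (8 * p * r : ℝ) ^ 2 ^ k ≤ n := by
        rw [← hzn]
        gcongr
      exact_mod_cast this)
    (by
      rw [hrdef, Nat.add_sub_cancel]
      exact le_trans (by gcongr; omega) hus)
  have hs0 : (0 : ℝ) < s := by exact_mod_cast (by omega : 0 < s)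
  have hls : 0 < Real.log s := Real.log_pos (by exact_mod_cast (by omega : 1 < s))
  have hl16 : 0 < Real.log (16 * r) := Real.log_pos (by exact_mod_cast (by omega : 1 < 16 * r))
  have hlz : 0 < Real.log z := hl16.trans_le (Real.log_le_log (by positivity) hrz)
  set L := Real.logb 2 (Real.log n / Real.log s) with hL
  have hL0 : 0 ≤ L := by
    refine Real.logb_nonneg (by norm_num) ?_
    rw [one_le_div hls]
    exact Real.log_le_log hs0 (by exact_mod_cast hsn)
  have hLk : L ≤ k + Real.logb 2 (Real.log z / Real.log (16 * r)) := by
    have hlog : Real.log n = 2 ^ k * Real.log z := by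
      rw [← hzn, Real.log_pow]
      push_cast
      rfl
    calc L = Real.logb 2 (2 ^ k * (Real.log z / Real.log s)) := by rw [hL, hlog, mul_div_assoc]
      _ ≤ Real.logb 2 (2 ^ k * (Real.log z / Real.log (16 * r))) := by
          refine Real.logb_le_logb_of_le (by norm_num) (by positivity) ?_
          gcongr
          exact_mod_cast hrs
      _ = _ := by
          rw [Real.logb_mul (by positivity) (by positivity), Real.logb_pow,
            Real.logb_self_eq_one (by norm_num), mul_one]
  have hana := rpow_div_le hr hrz hzr hs0 hsu' hL0 hLk
  have hcomb' : (n : ℝ) * (r ^ (k + 1) * p * u) ≤ 2 * lambdaDS s n := by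
    rw [hrdef, Nat.add_sub_cancel] at hcomb
    exact_mod_cast hcomb
  have hur : (r : ℝ) ≤ 2 * u := by exact_mod_cast (by omega : r ≤ 2 * u)
  have hpu : z ≤ 2048 * (p * u) := by
    calc z ≤ 1024 * p * r := hzp
      _ ≤ 1024 * p * (2 * u) := by gcongr
      _ = _ := by ring
  calc (n : ℝ) * ((s : ℝ) / (2 * L + 1)) ^ (L + 1) ≤ n * (z * r ^ (k + 1) / 4096) := by gcongr
    _ ≤ n * (2048 * (p * u) * r ^ (k + 1) / 4096) := by gcongr
    _ = n * (r ^ (k + 1) * p * u) / 2 := by ring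
    _ ≤ lambdaDS s n := by linarith
end

section
/- There exists a constant c > 0 such that for all integers s ≥ 2 and n ≥ 2, λ(s,n) ≥ c · min{n²·s, n·s²}. In particular, for s ≥ n, λ(s,n) ≥ c·n²·s, which together with the upper bound λ(s,n) ≤ (n choose 2)·s + 1 gives λ(s,n) = Θ(n²s) for s ≥ n. -/
namespace DavenportSchinzel

variable {α : Type*}

theorem length_altSeq (a b : α) (k : ℕ) : (altSeq a b k).length = k := by
  induction k generalizing a b with
  | zero => rfl
  | succ k ih => simp [altSeq, ih]

theorem altSeq_sublist_succ (a b : α) (k : ℕ) :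
    (altSeq a b k).Sublist (altSeq a b (k + 1)) := by
  induction k generalizing a b with
  | zero => simp [altSeq]
  | succ k ih => exact (ih b a).cons_cons a

theorem altSeq_sublist_of_le (a b : α) {k k' : ℕ} (h : k ≤ k') :
    (altSeq a b k).Sublist (altSeq a b k') := by
  induction h with
  | refl => exact List.Sublist.refl _
  | step _ ih => exact ih.trans (altSeq_sublist_succ a b _)

/-- An alternation in a concatenation splits into an alternation in each part. -/
theorem exists_altSeq_of_sublist_append {a b : α} {k : ℕ} {l₁ l₂ : List α}
    (h : (altSeq a b k).Sublist (l₁ ++ l₂)) :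
    ∃ i j, k = i + j ∧ (altSeq a b i).Sublist l₁ ∧
      ((altSeq a b j).Sublist l₂ ∨ (altSeq b a j).Sublist l₂) := by
  induction l₁ generalizing a b k with
  | nil => exact ⟨0, k, by simp, by simp [altSeq], Or.inl h⟩
  | cons x l₁ ih =>
    cases k with
    | zero => exact ⟨0, 0, rfl, by simp [altSeq], Or.inl (by simp [altSeq])⟩
    | succ k =>
      rw [List.cons_append, List.sublist_cons_iff] at h
      rcases h with h | ⟨r, hr, h⟩
      · obtain ⟨i, j, hk, h₁, h₂⟩ := ih h
        exact ⟨i, j, hk, h₁.cons x, h₂⟩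
      · rw [altSeq, List.cons.injEq] at hr
        obtain ⟨rfl, rfl⟩ := hr
        obtain ⟨i, j, hk, h₁, h₂⟩ := ih h
        exact ⟨i + 1, j, by omega, h₁.cons_cons _, h₂.symm⟩

/-! ### The upper bound -/

/-- The unordered pairs of consecutive entries of a list. -/
def adjacentPairs : List α → List (Sym2 α)
  | [] => []
  | [_] => []
  | x :: y :: l => s(x, y) :: adjacentPairs (y :: l)

theorem length_adjacentPairs_cons (x : α) (l : List α) :
    (adjacentPairs (x :: l)).length = l.length := by
  induction l generalizing x with
  | nil => rfl
  | cons y l ih => simp [adjacentPairs, ih]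

theorem not_isDiag_of_mem_adjacentPairs {l : List α} (h : l.IsChain (· ≠ ·)) :
    ∀ e ∈ adjacentPairs l, ¬ e.IsDiag := by
  induction l with
  | nil => simp [adjacentPairs]
  | cons x l ih =>
    cases l with
    | nil => simp [adjacentPairs]
    | cons y l =>
      rw [List.isChain_cons_cons] at h
      intro e he
      rw [adjacentPairs, List.mem_cons] at he
      rcases he with rfl | he
      · simpa using h.1
      · exact ih h.2 e he

/-- If `{a, b}` occurs `t` times as a pair of consecutive entries, there is an alternation of
length `t + 1`; it may be chosen to start with the first entry if that is `a` or `b`. -/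
theorem exists_altSeq_of_count_adjacentPairs [DecidableEq α] {a b : α} (hab : a ≠ b) (x : α)
    (l : List α) {t : ℕ} (ht : (adjacentPairs (x :: l)).count s(a, b) = t) :
    (x = a → (altSeq a b (t + 1)).Sublist (x :: l)) ∧
    (x = b → (altSeq b a (t + 1)).Sublist (x :: l)) ∧
    (t = 0 ∨ (altSeq a b (t + 1)).Sublist (x :: l) ∨ (altSeq b a (t + 1)).Sublist (x :: l)) := by
  induction l generalizing x t with
  | nil =>
    simp only [adjacentPairs, List.count_nil] at ht
    subst ht
    refine ⟨?_, ?_, Or.inl rfl⟩ <;> rintro rfl <;> simp [altSeq]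
  | cons y l ih =>
    rw [adjacentPairs, List.count_cons] at ht
    obtain ⟨h₁, h₂, h₃⟩ := ih y rfl
    set t' := (adjacentPairs (y :: l)).count s(a, b)
    by_cases hxy : s(x, y) = s(a, b)
    · simp only [hxy, beq_self_eq_true, if_true] at ht
      subst ht
      rw [Sym2.eq_iff] at hxy
      rcases hxy with ⟨rfl, rfl⟩ | ⟨rfl, rfl⟩
      · have h := (h₂ rfl).cons_cons x
        exact ⟨fun _ => h, fun e => absurd e hab, Or.inr (Or.inl h)⟩
      · have h := (h₁ rfl).cons_cons x
        exact ⟨fun e => absurd e.symm hab, fun _ => h, Or.inr (Or.inr h)⟩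
    · simp only [beq_iff_eq, hxy, if_false, add_zero] at ht
      subst ht
      refine ⟨?_, ?_, ?_⟩
      · rintro rfl
        rcases h₃ with h₃ | h₃ | h₃
        · rw [h₃]; simp [altSeq]
        · exact h₃.cons _
        · exact ((altSeq_sublist_succ _ _ _).trans h₃).cons_cons x
      · rintro rfl
        rcases h₃ with h₃ | h₃ | h₃
        · rw [h₃]; simp [altSeq]
        · exact ((altSeq_sublist_succ _ _ _).trans h₃).cons_cons x
        · exact h₃.cons _
      · exact h₃.imp id (Or.imp (·.cons x) (·.cons x))

theorem length_le_of_isDS {s n : ℕ} {l : List (Fin n)} (h : IsDS s n l) :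
    l.length ≤ n.choose 2 * s + 1 := by
  obtain ⟨hc, ha⟩ := h
  cases l with
  | nil => simp
  | cons x l =>
    have hdiag := not_isDiag_of_mem_adjacentPairs hc
    have hcount : ∀ e ∈ (adjacentPairs (x :: l)).toFinset,
        (adjacentPairs (x :: l)).count e ≤ s := by
      intro e he
      have hd := hdiag e (List.mem_toFinset.1 he)
      induction e using Sym2.ind with
      | _ a b =>
        have hab : a ≠ b := by simpa using hd
        by_contra! hlt
        rcases (exists_altSeq_of_count_adjacentPairs hab x l rfl).2.2 with h | h | h
        · omega
        · exact ha a b hab ((altSeq_sublist_of_le a b (by omega)).trans h)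
        · exact ha b a hab.symm ((altSeq_sublist_of_le b a (by omega)).trans h)
    have hcard : (adjacentPairs (x :: l)).toFinset.card ≤ n.choose 2 := by
      have := Sym2.card_subtype_not_diag (α := Fin n)
      rw [Fintype.card_fin, Fintype.card_subtype] at this
      rw [← this]
      refine Finset.card_le_card fun e he => ?_
      simpa using hdiag e (List.mem_toFinset.1 he)
    have hlen := List.sum_toFinset_count_eq_length (adjacentPairs (x :: l))
    rw [length_adjacentPairs_cons] at hlen
    have := (Finset.sum_le_card_nsmul _ _ s hcount).trans (Nat.mul_le_mul_right s hcard)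
    simp only [List.length_cons]
    omega

theorem lambdaDS_le (s n : ℕ) : lambdaDS s n ≤ n.choose 2 * s + 1 := by
  refine csSup_le' ?_
  rintro L ⟨l, hl, rfl⟩
  exact length_le_of_isDS hl

theorem length_le_lambdaDS {s n : ℕ} {l : List (Fin n)} (h : IsDS s n l) :
    l.length ≤ lambdaDS s n := by
  refine le_csSup ⟨n.choose 2 * s + 1, ?_⟩ ⟨l, h, rfl⟩
  rintro L ⟨l, hl, rfl⟩
  exact length_le_of_isDS hl

/-! ### The lower bound -/

theorem le_lambdaDS_self {s n : ℕ} (hs : 1 ≤ s) : n ≤ lambdaDS s n := by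
  have h : IsDS s n (List.finRange n) := by
    refine ⟨(List.nodup_finRange n).isChain, fun a b _ hsub => ?_⟩
    have := (List.nodup_finRange n).sublist
      ((altSeq_sublist_of_le a b (show 3 ≤ s + 2 by omega)).trans hsub)
    simp [altSeq] at this
  simpa using length_le_lambdaDS h

/-- The list `x₁, y₁, x₂, y₂, ...` obtained from a list of pairs. -/
def flattenPairs (L : List (α × α)) : List α :=
  L.flatMap fun e => [e.1, e.2]

theorem length_flattenPairs (L : List (α × α)) : (flattenPairs L).length = 2 * L.length := by
  simp [flattenPairs, mul_comm]

theorem isChain_flattenPairs (p : α → Prop) {L : List (α × α)}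
    (hp : ∀ e ∈ L, p e.1 ∧ ¬ p e.2) : (flattenPairs L).IsChain (· ≠ ·) := by
  induction L with
  | nil => simp [flattenPairs]
  | cons e L ih =>
    have he := hp e (by simp)
    have hne : e.1 ≠ e.2 := fun h => he.2 (h ▸ he.1)
    have ih := ih fun e' he' => hp e' (by simp [he'])
    cases L with
    | nil => simpa [flattenPairs] using hne
    | cons e' L =>
      have hne' : e.2 ≠ e'.1 := fun h => he.2 (h ▸ (hp e' (by simp)).1)
      simp only [flattenPairs, List.flatMap_cons, List.cons_append, List.nil_append,
        List.isChain_cons_cons] at ih ⊢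
      exact ⟨hne, hne', ih⟩

theorem le_of_altSeq_sublist_replicate [DecidableEq α] {a b : α} {j k : ℕ} {e : α × α}
    (hab : a ≠ b) (h : (altSeq a b k).Sublist (flattenPairs (List.replicate j e))) :
    k ≤ (if e.1 = a ∨ e.2 = a then 1 else 0) + (if e.1 = b ∨ e.2 = b then 1 else 0) +
      2 * j * (if e = (a, b) ∨ e = (b, a) then 1 else 0) := by
  have hlen : k ≤ 2 * j := by
    simpa [length_altSeq, length_flattenPairs] using h.length_le
  have hmem : ∀ c ∈ altSeq a b k, e.1 = c ∨ e.2 = c := by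
    intro c hc
    have := h.subset hc
    simp only [flattenPairs, List.mem_flatMap, List.mem_replicate] at this
    obtain ⟨e', ⟨-, rfl⟩, hc⟩ := this
    simpa [eq_comm] using hc
  obtain ⟨x, y⟩ := e
  match k with
  | 0 => omega
  | 1 =>
    have ha := hmem a (by simp [altSeq])
    rw [if_pos ha]
    omega
  | k + 2 =>
    have ha := hmem a (by simp [altSeq])
    have hb := hmem b (by simp [altSeq])
    have hE : (x, y) = (a, b) ∨ (x, y) = (b, a) := by
      simp only [Prod.mk.injEq] at *
      rcases ha with rfl | rfl <;> rcases hb with rfl | rfl <;> simp_all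
    rw [if_pos ha, if_pos hb, if_pos hE]
    omega

theorem le_of_altSeq_sublist_flattenPairs [DecidableEq α] (j : ℕ) (E : List (α × α)) {a b : α}
    {k : ℕ} (hab : a ≠ b)
    (h : (altSeq a b k).Sublist (flattenPairs (E.flatMap (List.replicate j)))) :
    k ≤ E.countP (fun e => e.1 = a ∨ e.2 = a) + E.countP (fun e => e.1 = b ∨ e.2 = b) +
      2 * j * E.countP (fun e => e = (a, b) ∨ e = (b, a)) := by
  induction E generalizing a b k with
  | nil => simpa [flattenPairs, length_altSeq] using h.length_le
  | cons e E ih =>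
    rw [List.flatMap_cons, flattenPairs, List.flatMap_append] at h
    obtain ⟨i, r, rfl, h₁, h₂⟩ := exists_altSeq_of_sublist_append h
    have h₁ := le_of_altSeq_sublist_replicate hab h₁
    have h₂ : r ≤ E.countP (fun e => e.1 = a ∨ e.2 = a) +
        E.countP (fun e => e.1 = b ∨ e.2 = b) +
        2 * j * E.countP (fun e => e = (a, b) ∨ e = (b, a)) := by
      rcases h₂ with h₂ | h₂
      · exact ih hab h₂
      · have := ih hab.symm h₂
        simp only [or_comm (a := _ = (b, a))] at this
        omega
    simp only [List.countP_cons, decide_eq_true_eq, mul_add]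
    omega

/-- Blow up the edges of a bipartite graph of maximum degree `m` to alternations of
length `2 * j`. -/
theorem isDS_flattenPairs {s n m j : ℕ} (hsj : 2 * m + 2 * j ≤ s + 1) (p : Fin n → Prop)
    {E : List (Fin n × Fin n)} (hp : ∀ e ∈ E, p e.1 ∧ ¬ p e.2) (hE : E.Nodup)
    (hdeg : ∀ a, E.countP (fun e => e.1 = a ∨ e.2 = a) ≤ m) :
    IsDS s n (flattenPairs (E.flatMap (List.replicate j))) := by
  refine ⟨isChain_flattenPairs p fun e he => ?_, fun a b hab h => ?_⟩
  · obtain ⟨e', he', h⟩ := List.mem_flatMap.1 he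
    rw [(List.mem_replicate.1 h).2]
    exact hp e' he'
  · have h := le_of_altSeq_sublist_flattenPairs j E hab h
    have hone : E.countP (fun e => e = (a, b) ∨ e = (b, a)) ≤ 1 := by
      have key : ∀ c d : Fin n, p c →
          E.countP (fun e => e = (c, d) ∨ e = (d, c)) ≤ E.count (c, d) := by
        intro c d hc
        refine List.countP_mono_left fun e he h => ?_
        simp only [decide_eq_true_eq] at h
        rcases h with rfl | rfl
        · simp
        · exact absurd hc (hp _ he).2
      by_cases ha : p a
      · exact (key a b ha).trans (List.nodup_iff_count_le_one.1 hE _)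
      · by_cases hb : p b
        · simp only [or_comm (a := _ = (a, b))]
          exact (key b a hb).trans (List.nodup_iff_count_le_one.1 hE _)
        · rw [List.countP_eq_zero.2]
          · omega
          · intro e he
            simp only [decide_eq_true_eq]
            rintro (rfl | rfl)
            · exact ha (hp _ he).1
            · exact hb (hp _ he).1
    have h₁ := hdeg a
    have h₂ := hdeg b
    have h₃ := Nat.mul_le_mul_left (2 * j) hone
    omega

theorem le_lambdaDS {s n N m j : ℕ} (hN : 2 * N ≤ n) (hm : m ≤ N)
    (hsj : 2 * m + 2 * j ≤ s + 1) : 2 * (N * m * j) ≤ lambdaDS s n := by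
  rcases Nat.eq_zero_or_pos N with rfl | hpos
  · simp
  have : NeZero N := ⟨hpos.ne'⟩
  obtain ⟨f⟩ : Nonempty (Fin N ⊕ Fin N ↪ Fin n) :=
    Function.Embedding.nonempty_of_card_le (by simp; omega)
  let g : Fin N × Fin m → Fin n × Fin n := fun q =>
    (f (Sum.inl q.1), f (Sum.inr (q.1 + Fin.castLE hm q.2)))
  have hg : Function.Injective g := by
    rintro ⟨i, d⟩ ⟨i', d'⟩ h
    simp only [g, Prod.mk.injEq, f.injective.eq_iff, Sum.inl.injEq, Sum.inr.injEq] at h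
    obtain ⟨rfl, h⟩ := h
    rw [add_right_inj] at h
    simpa using h
  let E := (Finset.univ : Finset (Fin N × Fin m)).toList.map g
  have hDS : IsDS s n (flattenPairs (E.flatMap (List.replicate j))) := by
    refine isDS_flattenPairs hsj (fun a => ∃ i, f (Sum.inl i) = a) ?_
      ((Finset.nodup_toList _).map hg) fun a => ?_
    · intro e he
      obtain ⟨q, -, rfl⟩ := List.mem_map.1 he
      refine ⟨⟨q.1, rfl⟩, ?_⟩
      rintro ⟨i, hi⟩
      simp [g] at hi
    · have hcard : E.countP (fun e => e.1 = a ∨ e.2 = a) =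
          (Finset.univ.filter fun q => (g q).1 = a ∨ (g q).2 = a).card := by
        rw [List.countP_map, Finset.card_def, Finset.filter_val, ← Multiset.countP_eq_card_filter,
          ← Finset.coe_toList, Multiset.coe_countP]
        rfl
      rw [hcard]
      refine (Finset.card_le_card_of_injOn Prod.snd (t := (Finset.univ : Finset (Fin m)))
        (by simp) ?_).trans (by simp)
      rintro ⟨i, d⟩ hq ⟨i', d'⟩ hq' (rfl : d = d')
      simp only [g, Finset.coe_filter, Finset.mem_univ, true_and, Set.mem_ofPred_eq] at hq hq'
      rcases hq with rfl | rfl <;> rcases hq' with h | h <;>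
        simp [f.injective.eq_iff] at h <;> simp [h]
  have hlen := length_le_lambdaDS hDS
  simpa [length_flattenPairs, E, mul_assoc, mul_comm, mul_left_comm] using hlen

theorem mul_min_le_lambdaDS {s n : ℕ} (hs : 2 ≤ s) (hn : 2 ≤ n) :
    (1 / 54 : ℝ) * min ((n : ℝ) ^ 2 * s) ((n : ℝ) * (s : ℝ) ^ 2) ≤ (lambdaDS s n : ℝ) := by
  rcases hs.eq_or_lt with rfl | hs
  · have h : (n : ℝ) ≤ lambdaDS 2 n := by exact_mod_cast le_lambdaDS_self (by norm_num)
    have h' := min_le_right ((n : ℝ) ^ 2 * (2 : ℕ)) ((n : ℝ) * ((2 : ℕ) : ℝ) ^ 2)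
    have : (0 : ℝ) ≤ n := n.cast_nonneg
    generalize min ((n : ℝ) ^ 2 * (2 : ℕ)) ((n : ℝ) * ((2 : ℕ) : ℝ) ^ 2) = x at *
    push_cast at h'
    linarith
  · have h := le_lambdaDS (s := s) (n := n) (N := n / 2) (m := min (n / 2) ((s + 1) / 4))
      (j := (s + 1) / 4) (by omega) (min_le_left _ _) (by omega)
    have hN : (n : ℝ) ≤ 3 * (n / 2 : ℕ) := by exact_mod_cast (by omega : n ≤ 3 * (n / 2))
    have hj : (s : ℝ) ≤ 6 * ((s + 1) / 4 : ℕ) := by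
      exact_mod_cast (by omega : s ≤ 6 * ((s + 1) / 4))
    generalize n / 2 = N at *
    generalize (s + 1) / 4 = j at *
    have hs0 : (0 : ℝ) ≤ s := s.cast_nonneg
    have hn0 : (0 : ℝ) ≤ n := n.cast_nonneg
    have h : 2 * ((N : ℝ) * (min N j : ℕ) * j) ≤ lambdaDS s n := by exact_mod_cast h
    refine le_trans ?_ h
    rcases le_total N j with hNj | hNj
    · rw [min_eq_left hNj]
      calc _ ≤ (1 / 54 : ℝ) * ((n : ℝ) ^ 2 * s) := by gcongr; exact min_le_left _ _
        _ ≤ (1 / 54 : ℝ) * ((3 * N : ℝ) ^ 2 * (6 * j)) := by gcongr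
        _ ≤ _ := by
          have : (0 : ℝ) ≤ (N : ℝ) * N * j := by positivity
          linarith
    · rw [min_eq_right hNj]
      calc _ ≤ (1 / 54 : ℝ) * ((n : ℝ) * (s : ℝ) ^ 2) := by gcongr; exact min_le_right _ _
        _ ≤ (1 / 54 : ℝ) * ((3 * N : ℝ) * (6 * j) ^ 2) := by gcongr
        _ ≤ _ := by
          have : (0 : ℝ) ≤ (N : ℝ) * j * j := by positivity
          linarith

end DavenportSchinzel

theorem stmt14 :
    ∃ c : ℝ, 0 < c ∧
      (∀ s n : ℕ, 2 ≤ s → 2 ≤ n →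
        c * min ((n : ℝ) ^ 2 * s) ((n : ℝ) * (s : ℝ) ^ 2) ≤ (lambdaDS s n : ℝ)) ∧
      (∀ s n : ℕ, 2 ≤ n → n ≤ s →
        c * (n : ℝ) ^ 2 * s ≤ (lambdaDS s n : ℝ) ∧
        (lambdaDS s n : ℝ) ≤ n.choose 2 * s + 1) := by
  refine ⟨1 / 54, by norm_num, fun s n hs hn => DavenportSchinzel.mul_min_le_lambdaDS hs hn,
    fun s n hn hns => ⟨?_, by exact_mod_cast DavenportSchinzel.lambdaDS_le s n⟩⟩
  have h := DavenportSchinzel.mul_min_le_lambdaDS (hn.trans hns) hn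
  have hns' : (n : ℝ) ≤ s := by exact_mod_cast hns
  rwa [min_eq_left, ← mul_assoc] at h
  rw [sq, sq, mul_assoc]
  gcongr
end
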